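/- Reshetikhin condition with vanishing right-hand side: with H the 9×9 matrix below, setting H₁₂ = H ⊗ I₃ and H₂₃ = I₃ ⊗ H (27×27 matrices, ⊗ the Kronecker product), the double commutator vanishes: [H₁₂ + H₂₃, [H₁₂, H₂₃]] = 0. -/

import Mathlib

open Matrix Kronecker

noncomputable section

structure Params where
  m11p : ℝ
  m11m : ℝ
  m12p : ℝ
  m12m : ℝ
  m21p : ℝ
  m21m : ℝ

namespace Resh

variable (Pm : Params)

def xP : ℝ := (Pm.m11p + Pm.m11m) / 2
def xM : ℝ := (Pm.m11p - Pm.m11m) / 2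
def yP : ℝ := (Pm.m12p + Pm.m12m) / 2
def yM : ℝ := (Pm.m12p - Pm.m12m) / 2
def zP : ℝ := (Pm.m21p + Pm.m21m) / 2
def zM : ℝ := (Pm.m21p - Pm.m21m) / 2

/-- the 9×9 Hamiltonian density H = R̂′(0): diagonal entries (x₊,y₊,x₊,z₊,0,z₊,x₊,y₊,x₊) and
antidiagonal entries (x₋,y₋,x₋,z₋,·,z₋,x₋,y₋,x₋) off the centre (rows/columns 1,…,9 ↦
`Fin 9` values 0,…,8) -/
def Hmat : Matrix (Fin 9) (Fin 9) ℝ := fun i j =>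
  (if i = j then ![xP Pm, yP Pm, xP Pm, zP Pm, 0, zP Pm, xP Pm, yP Pm, xP Pm] i else 0)
  + (if i.1 + j.1 = 8 ∧ i.1 ≠ 4 then
      ![xM Pm, yM Pm, xM Pm, zM Pm, 0, zM Pm, xM Pm, yM Pm, xM Pm] i
    else 0)

/-- identification of `Fin 9` with `Fin 3 × Fin 3` (lexicographic order) -/
def enc (a : Fin 3 × Fin 3) : Fin 9 := ⟨3 * a.1.1 + a.2.1, by omega⟩

/-- H viewed as a matrix on `Fin 3 × Fin 3` -/
def Hpair : Matrix (Fin 3 × Fin 3) (Fin 3 × Fin 3) ℝ := fun a b => Hmat Pm (enc a) (enc b)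

/-- H₁₂ = H ⊗ I₃ -/
def H12 : Matrix (Fin 3 × Fin 3 × Fin 3) (Fin 3 × Fin 3 × Fin 3) ℝ :=
  Matrix.reindex (Equiv.prodAssoc (Fin 3) (Fin 3) (Fin 3)) (Equiv.prodAssoc (Fin 3) (Fin 3) (Fin 3))
    (Hpair Pm ⊗ₖ (1 : Matrix (Fin 3) (Fin 3) ℝ))

/-- H₂₃ = I₃ ⊗ H -/
def H23 : Matrix (Fin 3 × Fin 3 × Fin 3) (Fin 3 × Fin 3 × Fin 3) ℝ :=
  (1 : Matrix (Fin 3) (Fin 3) ℝ) ⊗ₖ Hpair Pm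

end Resh

namespace Resh

def tab (x y z : ℝ) (a b : Fin 3) : ℝ := ![![x, y, x], ![z, 0, z], ![x, y, x]] a b

lemma tab_rev_left (x y z : ℝ) (a b : Fin 3) : tab x y z a.rev b = tab x y z a b := by
  fin_cases a <;> rfl

lemma tab_rev_right (x y z : ℝ) (a b : Fin 3) : tab x y z a b.rev = tab x y z a b := by
  fin_cases a <;> fin_cases b <;> rfl

lemma Hpair_apply (Pm : Params) (a b c e : Fin 3) :
    Hpair Pm (a, b) (c, e) =
      (if a = c ∧ b = e then tab (xP Pm) (yP Pm) (zP Pm) a b else 0)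
      + (if a.rev = c ∧ b.rev = e then tab (xM Pm) (yM Pm) (zM Pm) a b else 0) := by
  fin_cases a <;> fin_cases b <;> fin_cases c <;> fin_cases e <;>
    simp [Hpair, Hmat, enc, tab, Fin.rev, Fin.ext_iff]

lemma H12_mul (Pm : Params) {n : Type*} (X : Matrix (Fin 3 × Fin 3 × Fin 3) n ℝ)
    (i j k : Fin 3) (q : n) :
    (H12 Pm * X) (i, j, k) q = tab (xP Pm) (yP Pm) (zP Pm) i j * X (i, j, k) q
      + tab (xM Pm) (yM Pm) (zM Pm) i j * X (i.rev, j.rev, k) q := by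
  simp [Matrix.mul_apply, Fintype.sum_prod_type, H12, Hpair_apply, Matrix.one_apply, add_mul,
    ite_and, Finset.sum_add_distrib]

lemma H23_mul (Pm : Params) {n : Type*} (X : Matrix (Fin 3 × Fin 3 × Fin 3) n ℝ)
    (i j k : Fin 3) (q : n) :
    (H23 Pm * X) (i, j, k) q = tab (xP Pm) (yP Pm) (zP Pm) j k * X (i, j, k) q
      + tab (xM Pm) (yM Pm) (zM Pm) j k * X (i, j.rev, k.rev) q := by
  simp [Matrix.mul_apply, Fintype.sum_prod_type, H23, Hpair_apply, Matrix.one_apply, add_mul,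
    ite_and, Finset.sum_add_distrib]

lemma H_comm (Pm : Params) : H12 Pm * H23 Pm = H23 Pm * H12 Pm := by
  have h : H12 Pm * (H23 Pm * 1) = H23 Pm * (H12 Pm * 1) := by
    ext ⟨i, j, k⟩ q
    simp only [H12_mul, H23_mul, tab_rev_left, tab_rev_right, Fin.rev_rev]
    ring
  simpa using h

end Resh

open Resh

/-- the Reshetikhin condition holds with vanishing right-hand side:
[H₁₂ + H₂₃, [H₁₂, H₂₃]] = 0. -/
theorem reshetikhin_vanishing (Pm : Params) :
    (H12 Pm + H23 Pm) * (H12 Pm * H23 Pm - H23 Pm * H12 Pm)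
      - (H12 Pm * H23 Pm - H23 Pm * H12 Pm) * (H12 Pm + H23 Pm) = 0 := by
  simp [H_comm]
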